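/- For any s > 0 and 0 < ε < (1/4)·min(s,1), it holds that ‖⟨∇⟩^s(u³) − 3u²⟨∇⟩^s u‖_{L²(𝕋²)} ≲ ‖u‖³_{C^{s−ε}(𝕋²)}, with implicit constant independent of u. -/

import Mathlib

noncomputable section
open scoped BigOperators ENNReal NNReal
open MeasureTheory Filter

namespace SDNLW

/-- The frequency lattice of the two-dimensional torus. -/
abbrev Freq : Type := ℤ × ℤ

/-- A distribution on `𝕋²`, represented by its Fourier coefficients. -/
abbrev Distr : Type := Freq → ℂ

/-- A pair `(u, v)` of distributions on `𝕋²`. -/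
abbrev VDistr : Type := Distr × Distr

/-- The Japanese bracket `⟨n⟩ = (1 + |n|²)^{1/2}`. -/
def jap (n : Freq) : ℝ := Real.sqrt (1 + (n.1 : ℝ) ^ 2 + (n.2 : ℝ) ^ 2)

/-- Euclidean length of a frequency. -/
def fnorm (n : Freq) : ℝ := Real.sqrt ((n.1 : ℝ) ^ 2 + (n.2 : ℝ) ^ 2)

/-- The Fourier multiplier `⟨∇⟩^σ = (1 - Δ)^{σ/2}`. -/
def japMul (σ : ℝ) (u : Distr) : Distr := fun n => (Complex.ofReal (jap n ^ σ)) * u n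

/-- The Fourier multiplier `|∇|^σ`, with symbol `|2πn|^σ`. -/
def absMul (σ : ℝ) (u : Distr) : Distr :=
  fun n => (Complex.ofReal ((2 * Real.pi * fnorm n) ^ σ)) * u n

/-- The partial derivative `∂_j`, with symbol `2πi n_j`. -/
def pd (j : Fin 2) (u : Distr) : Distr :=
  fun n => (2 * Real.pi * Complex.I * (if j = 0 then (n.1 : ℂ) else (n.2 : ℂ))) * u n

/-- The product of two distributions (convolution of Fourier coefficients). -/
def dmul (u v : Distr) : Distr := fun n => ∑' m : Freq, u m * v (n - m)

/-- The cube `u³` of a distribution. -/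
def cube (u : Distr) : Distr := dmul u (dmul u u)

/-- Littlewood–Paley projection `P_N`, `N = 2^j`. -/
def LP (j : ℕ) (u : Distr) : Distr :=
  Set.indicator {n : Freq |
    if j = 0 then fnorm n ≤ 1 else ((2 : ℝ) ^ (j - 1) < fnorm n ∧ fnorm n ≤ (2 : ℝ) ^ j)} u

/-- The sum of the Littlewood–Paley pieces `P_N f` over `N < M/2`, `M = 2^k`. -/
def lowPass (k : ℕ) (f : Distr) : Distr := ∑ j ∈ Finset.range (k - 1), LP j f

/-- The low-high paraproduct `f ≺ g = ∑_{N < M/2} P_N f · P_M g`. -/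
def para (f g : Distr) : Distr := fun n => ∑' k : ℕ, dmul (lowPass k f) (LP k g) n

/-- Evaluation of (the trigonometric series of) a distribution at a point. -/
def eval (u : Distr) (x : ℝ × ℝ) : ℂ :=
  ∑' n : Freq, u n * Complex.exp (Complex.I * Complex.ofReal ((n.1 : ℝ) * x.1 + (n.2 : ℝ) * x.2))

/-- The `L^∞` norm. -/
def linfNorm (u : Distr) : ℝ≥0∞ := ⨆ x : ℝ × ℝ, (‖eval u x‖₊ : ℝ≥0∞)

/-- The `L^p` norm on `𝕋² ≃ [0,2π]²`. -/
def lpNorm (p : ℝ) (u : Distr) : ℝ≥0∞ :=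
  (∫⁻ x in (Set.Icc (0:ℝ) (2 * Real.pi)) ×ˢ (Set.Icc (0:ℝ) (2 * Real.pi)),
      ((‖eval u x‖₊ : ℝ≥0∞) ^ p)) ^ (1 / p)

/-- The Sobolev `H^σ` norm. -/
def sobNorm (σ : ℝ) (u : Distr) : ℝ≥0∞ :=
  (∑' n : Freq, (‖u n‖₊ : ℝ≥0∞) ^ 2 * ENNReal.ofReal (jap n ^ (2 * σ))) ^ (1 / 2 : ℝ)

/-- Abstract Besov-type norm built from a norm on Littlewood–Paley pieces, with `q = ∞`. -/
def besovInf (σ : ℝ) (bn : Distr → ℝ≥0∞) (u : Distr) : ℝ≥0∞ :=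
  ⨆ j : ℕ, ENNReal.ofReal ((2 : ℝ) ^ ((j : ℝ) * σ)) * bn (LP j u)

/-- The Besov–Hölder norm `C^σ = B^σ_{∞,∞}`. -/
def CNorm (σ : ℝ) (u : Distr) : ℝ≥0∞ := besovInf σ linfNorm u

/-- The Besov norm `B^σ_{2,∞}`. -/
def B2InfNorm (σ : ℝ) (u : Distr) : ℝ≥0∞ := besovInf σ (sobNorm 0) u

/-- The `L²` norm. -/
def L2Norm (u : Distr) : ℝ≥0∞ := sobNorm 0 u

/-- The `W^{α,p}` Sobolev norm. -/
def WNorm (α p : ℝ) (u : Distr) : ℝ≥0∞ := lpNorm p (japMul α u)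

/-- The norm of `𝓒^α = C^α × C^{α-1}`. -/
def CvNorm (α : ℝ) (u : VDistr) : ℝ≥0∞ := CNorm α u.1 + CNorm (α - 1) u.2

/-- The norm of `𝓗^α = H^α × H^{α-1}`. -/
def HvNorm (α : ℝ) (u : VDistr) : ℝ≥0∞ := sobNorm α u.1 + sobNorm (α - 1) u.2

/-- The norm of `𝓦^{α,p} = W^{α,p} × W^{α-1,p}`. -/
def WvNorm (α p : ℝ) (u : VDistr) : ℝ≥0∞ := WNorm α p u.1 + WNorm (α - 1) p u.2

/-- The symbol of `⟪∇⟫ = (3/4 - Δ)^{1/2}`. -/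
def sb (n : Freq) : ℝ := Real.sqrt (3 / 4 + (n.1 : ℝ) ^ 2 + (n.2 : ℝ) ^ 2)

/-- The matrix propagator `S(t)` of the linear damped wave equation
`∂_t² u + ∂_t u + (1 - Δ) u = 0`. -/
def Sprop (t : ℝ) (u : VDistr) : VDistr :=
  (fun n => Complex.ofReal (Real.exp (-t / 2)) *
      (Complex.ofReal (Real.cos (t * sb n) + Real.sin (t * sb n) / (2 * sb n)) * u.1 n
        + Complex.ofReal (Real.sin (t * sb n) / sb n) * u.2 n),
   fun n => Complex.ofReal (Real.exp (-t / 2)) *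
      (Complex.ofReal (-((sb n + 1 / (4 * sb n)) * Real.sin (t * sb n))) * u.1 n
        + Complex.ofReal (Real.cos (t * sb n) - Real.sin (t * sb n) / (2 * sb n)) * u.2 n))

/-- Frequencies in the square `[-N, N]²` (all of them when `N = ∞`). -/
def sqSet (N : ℕ∞) : Set Freq := {n | (n.1.natAbs : ℕ∞) ≤ N ∧ (n.2.natAbs : ℕ∞) ≤ N}

/-- The sharp frequency projection `Π_{≤N}`. -/
def proj (N : ℕ∞) (u : Distr) : Distr := (sqSet N).indicator u

/-- The sharp frequency projection `Π_{≤N}` on pairs. -/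
def projV (N : ℕ∞) (u : VDistr) : VDistr := (proj N u.1, proj N u.2)

/-- Encoding of the index set `2^{ℕ₀} ∪ {∞}`: `some j ↦ 2^j`, `none ↦ ∞`. -/
def dyadic : Option ℕ → ℕ∞
  | none => ⊤
  | some j => ((2 ^ j : ℕ) : ℕ∞)

/-- The `X^α` norm: for `0 < α < 1` it is `sup_{t ≥ 0} e^{t/8} ‖S(t)u⃗‖_{𝓦^{α,2/α}}`;
for `α ≥ 1` it is the `H^α × H^{α-1}` norm. -/
def XNorm (α : ℝ) (u : VDistr) : ℝ≥0∞ :=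
  if α < 1 then
    ⨆ t : ℝ≥0, ENNReal.ofReal (Real.exp ((t : ℝ) / 8)) * WvNorm α (2 / α) (Sprop (t : ℝ) u)
  else HvNorm α u

/-- The `Z^α` norm `sup_{t ≥ 0} e^{t/8} ‖S(t)u⃗‖_{𝓒^α}`. -/
def ZNorm (α : ℝ) (u : VDistr) : ℝ≥0∞ :=
  ⨆ t : ℝ≥0, ENNReal.ofReal (Real.exp ((t : ℝ) / 8)) * CvNorm α (Sprop (t : ℝ) u)

/-- Trigonometric polynomials: pairs with finitely many nonzero Fourier coefficients. -/
def IsTrigPoly (u : VDistr) : Prop :=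
  (Function.support u.1).Finite ∧ (Function.support u.2).Finite

/-- Membership in `X^α` (the closure of trigonometric polynomials in the `X^α` norm). -/
def memX (α : ℝ) (u : VDistr) : Prop :=
  ∀ ε : ℝ≥0∞, 0 < ε → ∃ v : VDistr, IsTrigPoly v ∧ XNorm α (u - v) < ε

/-- Membership in `Z^α` (the closure of trigonometric polynomials in the `Z^α` norm). -/
def memZ (α : ℝ) (u : VDistr) : Prop :=
  ∀ ε : ℝ≥0∞, 0 < ε → ∃ v : VDistr, IsTrigPoly v ∧ ZNorm α (u - v) < ε

/-- Continuity of a path with respect to the `Z^α` norm, on `[0, ∞)`. -/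
def ZCont (α : ℝ) (f : ℝ → VDistr) : Prop :=
  ∀ t : ℝ, 0 ≤ t → ∀ ε : ℝ≥0∞, 0 < ε → ∃ δ : ℝ, 0 < δ ∧
    ∀ t' : ℝ, 0 ≤ t' → |t' - t| < δ → ZNorm α (f t' - f t) < ε

/-- Continuity of a path on `[0,T]` with respect to the `H^β × H^{β-1}` norm,
together with finiteness of the norm. -/
def HContOn (β T : ℝ) (f : ℝ → VDistr) : Prop :=
  (∀ t ∈ Set.Icc (0 : ℝ) T, HvNorm β (f t) ≠ ⊤) ∧
  ∀ t ∈ Set.Icc (0 : ℝ) T, ∀ ε : ℝ≥0∞, 0 < ε → ∃ δ : ℝ, 0 < δ ∧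
    ∀ t' ∈ Set.Icc (0 : ℝ) T, |t' - t| < δ → HvNorm β (f t' - f t) < ε

/-- `σ_N = ∑_{|n|_∞ ≤ N} ⟨n⟩^{-2}`. -/
def sigmaN (N : ℕ) : ℝ :=
  ∑' n : Freq, Set.indicator (sqSet (N : ℕ∞)) (fun m => jap m ^ (-2 : ℝ)) n

/-- The renormalised square `Q_{s,N}(u) = (⟨∇⟩^s Π_{≤N} u)² - σ_N`. -/
def QsN (s : ℝ) (N : ℕ) (u : Distr) : Distr :=
  fun n => dmul (japMul s (proj (N : ℕ∞) u)) (japMul s (proj (N : ℕ∞) u)) n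
    - (if n = 0 then (Complex.ofReal (sigmaN N)) else 0)

/-- The integral over `𝕋²` of (the function represented by) a distribution. -/
def intT2 (f : Distr) : ℝ := (2 * Real.pi) ^ 2 * (f 0).re

/-- The `L²(𝕋²)` pairing of two (real-valued) distributions. -/
def pairL2 (f g : Distr) : ℝ := (2 * Real.pi) ^ 2 * (∑' n : Freq, f n * (starRingEnd ℂ) (g n)).re

/-- The renormalised potential
`R_{s,N}(u) = (3/2) ∫ Q_{s,N}(u) (Π_{≤N}u)² + (1/4) ∫ (Π_{≤N}u)⁴`. -/
def RsN (s : ℝ) (N : ℕ) (u : Distr) : ℝ :=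
  (3 / 2) * intT2 (dmul (QsN s N u) (dmul (proj (N : ℕ∞) u) (proj (N : ℕ∞) u)))
  + (1 / 4) * intT2 (dmul (dmul (proj (N : ℕ∞) u) (proj (N : ℕ∞) u))
      (dmul (proj (N : ℕ∞) u) (proj (N : ℕ∞) u)))

/-- `Q_s(u)` exists and equals `Q` in the sense of convergence of `Q_{s,N}(u)` in `H^{α-s}`. -/
def QsLim (s α : ℝ) (u Q : Distr) : Prop :=
  Tendsto (fun N : ℕ => sobNorm (α - s) (QsN s N u - Q)) atTop (nhds 0)

end SDNLW

/-- Trigonometric polynomials on `𝕋²`, as the group algebra of the frequency lattice. -/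
abbrev TrigPoly : Type := AddMonoidAlgebra ℂ SDNLW.Freq

namespace SDNLW

/-- The normalised Haar measure on the circle. -/
local instance circleMeasureSpace : MeasureSpace UnitAddCircle := ⟨AddCircle.haarAddCircle⟩

local instance : Measure.IsAddHaarMeasure (volume : Measure UnitAddCircle) :=
  inferInstanceAs (Measure.IsAddHaarMeasure AddCircle.haarAddCircle)

local instance : IsProbabilityMeasure (volume : Measure UnitAddCircle) :=
  inferInstanceAs (IsProbabilityMeasure AddCircle.haarAddCircle)

/-- The continuous function on the torus represented by a trigonometric polynomial. -/
def toTorus : TrigPoly →ₐ[ℂ] C(UnitAddTorus (Fin 2), ℂ) :=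
  AddMonoidAlgebra.lift ℂ _ _
    { toFun := fun n => UnitAddTorus.mFourier ![n.toAdd.1, n.toAdd.2]
      map_one' := by
        rw [← UnitAddTorus.mFourier_zero]
        congr 1
        ext i; fin_cases i <;> rfl
      map_mul' := fun m n => by
        ext x
        rw [ContinuousMap.mul_apply, ← UnitAddTorus.mFourier_add]
        congr 2
        ext i; fin_cases i <;> rfl }

/-- The class in `L²` of a trigonometric polynomial. -/
def toL2 : TrigPoly →ₗ[ℂ] Lp ℂ 2 (volume : Measure (UnitAddTorus (Fin 2))) :=
  (ContinuousMap.toLp 2 volume ℂ).toLinearMap ∘ₗ toTorus.toLinearMap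

lemma toTorus_eq_sum (p : TrigPoly) :
    toTorus p = ∑ n ∈ p.coeff.support, p.coeff n • UnitAddTorus.mFourier ![n.1, n.2] := by
  rw [toTorus, AddMonoidAlgebra.lift_apply]
  rfl

lemma orthonormal_freq : Orthonormal ℂ
    (fun n : Freq => UnitAddTorus.mFourierLp (d := Fin 2) 2 ![n.1, n.2]) := by
  refine UnitAddTorus.orthonormal_mFourier.comp (fun n : Freq => ![n.1, n.2]) ?_
  intro a b h
  have h0 := congrFun h 0
  have h1 := congrFun h 1
  exact Prod.ext h0 h1

lemma toL2_eq_sum (p : TrigPoly) :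
    toL2 p = ∑ n ∈ p.coeff.support, p.coeff n • UnitAddTorus.mFourierLp 2 ![n.1, n.2] := by
  simp only [toL2, LinearMap.comp_apply, AlgHom.toLinearMap_apply, toTorus_eq_sum,
    map_sum, map_smul]
  rfl

lemma norm_toL2_sq (p : TrigPoly) :
    ‖toL2 p‖ ^ 2 = ∑ n ∈ p.coeff.support, ‖p.coeff n‖ ^ 2 := by
  have h := orthonormal_freq.inner_sum p.coeff p.coeff p.coeff.support
  rw [← toL2_eq_sum, inner_self_eq_norm_sq_to_K] at h
  have h2 : ((‖toL2 p‖ ^ 2 : ℝ) : ℂ)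
      = ((∑ n ∈ p.coeff.support, ‖p.coeff n‖ ^ 2 : ℝ) : ℂ) := by
    push_cast
    rw [show ((‖toL2 p‖ : ℂ)) ^ 2 = _ from h]
    exact Finset.sum_congr rfl fun n _ => by rw [Complex.conj_mul']
  exact_mod_cast h2

lemma hasSum_norm_toL2_sq (p : TrigPoly) :
    HasSum (fun n => ‖p.coeff n‖ ^ 2) (‖toL2 p‖ ^ 2) := by
  rw [norm_toL2_sq]
  exact hasSum_sum_of_ne_finset_zero fun n hn => by
    rw [Finsupp.notMem_support_iff.mp hn]; simp

lemma norm_toL2_mul_le (g f : TrigPoly) : ‖toL2 (g * f)‖ ≤ ‖toTorus g‖ * ‖toL2 f‖ := by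
  refine Lp.norm_le_mul_norm_of_ae_le_mul ?_
  have h1 := ContinuousMap.coeFn_toLp (E := ℂ) (p := 2) (𝕜 := ℂ)
    (volume : Measure (UnitAddTorus (Fin 2))) (toTorus (g * f))
  have h2 := ContinuousMap.coeFn_toLp (E := ℂ) (p := 2) (𝕜 := ℂ)
    (volume : Measure (UnitAddTorus (Fin 2))) (toTorus f)
  filter_upwards [h1, h2] with x h1 h2
  change ‖(ContinuousMap.toLp 2 volume ℂ (toTorus (g * f))) x‖ ≤
    _ * ‖(ContinuousMap.toLp 2 volume ℂ (toTorus f)) x‖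
  rw [h1, h2, map_mul, ContinuousMap.mul_apply, norm_mul]
  gcongr
  exact ContinuousMap.norm_coe_le_norm _ _

lemma norm_toL2_one_le : ‖toL2 1‖ ≤ 1 := by
  have h := norm_toL2_sq (AddMonoidAlgebra.single 0 1)
  rw [AddMonoidAlgebra.coeff_single, Finsupp.support_single _ one_ne_zero] at h
  simp only [Finset.sum_singleton, Finsupp.single_eq_same, norm_one] at h
  change ‖toL2 1‖ ^ 2 = _ at h
  nlinarith [norm_nonneg (toL2 1)]

lemma norm_toL2_le (f : TrigPoly) : ‖toL2 f‖ ≤ ‖toTorus f‖ := by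
  have := norm_toL2_mul_le f 1
  rw [mul_one] at this
  exact this.trans (mul_le_of_le_one_right (norm_nonneg _) norm_toL2_one_le)

lemma norm_toL2_le_of_coeff_le {p q : TrigPoly} {c : ℝ} (hc : 0 ≤ c)
    (h : ∀ n, ‖p.coeff n‖ ≤ c * ‖q.coeff n‖) : ‖toL2 p‖ ≤ c * ‖toL2 q‖ := by
  refine pow_le_pow_iff_left₀ (norm_nonneg _) (by positivity) two_ne_zero |>.1 ?_
  rw [mul_pow]
  refine hasSum_le (fun n => ?_) (hasSum_norm_toL2_sq p) ((hasSum_norm_toL2_sq q).mul_left (c ^ 2))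
  rw [← mul_pow]
  gcongr
  exact h n

lemma norm_coeff_le (p : TrigPoly) (n : Freq) : ‖p.coeff n‖ ≤ ‖toL2 p‖ := by
  refine pow_le_pow_iff_left₀ (norm_nonneg _) (norm_nonneg _) two_ne_zero |>.1 ?_
  exact le_hasSum (hasSum_norm_toL2_sq p) n fun _ _ => by positivity

lemma norm_toTorus_single_le (n : Freq) (a : ℂ) :
    ‖toTorus (AddMonoidAlgebra.single n a)‖ ≤ ‖a‖ := by
  rw [toTorus, AddMonoidAlgebra.lift_single, norm_smul]
  change ‖a‖ * ‖UnitAddTorus.mFourier ![n.1, n.2]‖ ≤ _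
  rw [UnitAddTorus.mFourier_norm, mul_one]

lemma eval_coeff (p : TrigPoly) (x : ℝ × ℝ) :
    eval p.coeff x = ∑ n ∈ p.coeff.support, p.coeff n *
      Complex.exp (Complex.I * Complex.ofReal ((n.1 : ℝ) * x.1 + (n.2 : ℝ) * x.2)) := by
  refine tsum_eq_sum fun n hn => ?_
  rw [Finsupp.notMem_support_iff.mp hn, zero_mul]

lemma norm_toTorus_le {p : TrigPoly} {M : ℝ} (hM : 0 ≤ M)
    (h : ∀ x, ‖eval p.coeff x‖ ≤ M) : ‖toTorus p‖ ≤ M := by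
  refine (ContinuousMap.norm_le _ hM).2 fun t => ?_
  obtain ⟨a, ha⟩ := QuotientAddGroup.mk_surjective (t 0)
  obtain ⟨b, hb⟩ := QuotientAddGroup.mk_surjective (t 1)
  refine le_of_eq_of_le ?_ (h (2 * Real.pi * a, 2 * Real.pi * b))
  rw [eval_coeff, toTorus_eq_sum, ContinuousMap.sum_apply]
  congr 1
  refine Finset.sum_congr rfl fun n _ => ?_
  rw [ContinuousMap.smul_apply, smul_eq_mul]
  congr 1
  simp only [UnitAddTorus.mFourier, ContinuousMap.coe_mk, Fin.prod_univ_two, ← ha, ← hb]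
  change fourier n.1 (a : UnitAddCircle) * fourier n.2 (b : UnitAddCircle) = _
  rw [fourier_coe_apply, fourier_coe_apply, ← Complex.exp_add]
  congr 1
  push_cast
  ring

lemma dmul_coeff (p q : TrigPoly) : dmul p.coeff q.coeff = (p * q).coeff := by
  funext n
  rw [dmul, AddMonoidAlgebra.coeff_mul, Finsupp.sum]
  rw [tsum_eq_sum (s := p.coeff.support) fun m hm => by
    rw [Finsupp.notMem_support_iff.mp hm, zero_mul]]
  refine Finset.sum_congr rfl fun m _ => ?_
  rw [Finsupp.sum, Finset.sum_eq_single (n - m)]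
  · simp
  · intro k _ hk
    rw [if_neg]
    intro h
    exact hk (by rw [← h]; abel)
  · intro h
    simp [Finsupp.notMem_support_iff.mp h]

/-- The Fourier multiplier with symbol `w`, acting on trigonometric polynomials. -/
def fourierMul (w : Freq → ℂ) : TrigPoly →ₗ[ℂ] TrigPoly where
  toFun p := .ofCoeff (Finsupp.onFinset p.coeff.support (fun n => w n * p.coeff n)
    fun n hn => Finsupp.mem_support_iff.2 (right_ne_zero_of_mul hn))
  map_add' p q := by
    ext n
    simp [mul_add]
  map_smul' c p := by
    ext n
    simp [mul_left_comm]

@[simp] lemma coeff_fourierMul (w : Freq → ℂ) (p : TrigPoly) (n : Freq) :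
    (fourierMul w p).coeff n = w n * p.coeff n := rfl

/-- The operator `⟨∇⟩^s` on trigonometric polynomials. -/
def bracketPow (s : ℝ) : TrigPoly →ₗ[ℂ] TrigPoly := fourierMul fun n => ((jap n ^ s : ℝ) : ℂ)

lemma coeff_bracketPow (s : ℝ) (p : TrigPoly) (n : Freq) :
    (bracketPow s p).coeff n = ((jap n ^ s : ℝ) : ℂ) * p.coeff n := rfl

lemma one_le_jap (n : Freq) : 1 ≤ jap n := by
  rw [jap, Real.one_le_sqrt]
  nlinarith [sq_nonneg (n.1 : ℝ), sq_nonneg (n.2 : ℝ)]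

lemma jap_pos (n : Freq) : 0 < jap n := zero_lt_one.trans_le (one_le_jap n)

lemma fnorm_nonneg (n : Freq) : 0 ≤ fnorm n := Real.sqrt_nonneg _

lemma fnorm_le_jap (n : Freq) : fnorm n ≤ jap n :=
  Real.sqrt_le_sqrt (by linarith)

lemma jap_le_one_add_fnorm (n : Freq) : jap n ≤ 1 + fnorm n := by
  have h := Real.sq_sqrt (show (0 : ℝ) ≤ (n.1 : ℝ) ^ 2 + (n.2 : ℝ) ^ 2 by positivity)
  rw [jap]
  refine Real.sqrt_le_iff.2 ⟨by linarith [fnorm_nonneg n], ?_⟩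
  have h0 := fnorm_nonneg n
  rw [fnorm] at *
  nlinarith

lemma fnorm_eq_norm (n : Freq) : fnorm n = ‖!₂[(n.1 : ℝ), (n.2 : ℝ)]‖ := by
  simp [fnorm, EuclideanSpace.norm_eq, Fin.sum_univ_two]

lemma jap_eq_norm (n : Freq) : jap n = ‖!₂[(1 : ℝ), (n.1 : ℝ), (n.2 : ℝ)]‖ := by
  simp [jap, EuclideanSpace.norm_eq, Fin.sum_univ_three]

lemma fnorm_add_le (m n : Freq) : fnorm (m + n) ≤ fnorm m + fnorm n := by
  simp only [fnorm_eq_norm]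
  refine le_of_eq_of_le ?_ (norm_add_le _ _)
  congr 1
  ext i; fin_cases i <;> simp

lemma fnorm_neg (n : Freq) : fnorm (-n) = fnorm n := by
  simp [fnorm]

lemma abs_jap_add_sub_le (m k : Freq) : |jap (m + k) - jap m| ≤ fnorm k := by
  rw [jap_eq_norm, jap_eq_norm]
  refine (abs_norm_sub_norm_le _ _).trans_eq ?_
  simp [fnorm, EuclideanSpace.norm_eq, Fin.sum_univ_three]

/-- The trigonometric polynomial `p` has all its frequencies in the disk of radius `R`. -/
def FreqBound (R : ℝ) (p : TrigPoly) : Prop := ∀ n, p.coeff n ≠ 0 → fnorm n ≤ R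

lemma FreqBound.mono {R R' : ℝ} {p : TrigPoly} (h : FreqBound R p) (hR : R ≤ R') :
    FreqBound R' p := fun n hn => (h n hn).trans hR

lemma FreqBound.add {R : ℝ} {p q : TrigPoly} (hp : FreqBound R p) (hq : FreqBound R q) :
    FreqBound R (p + q) := by
  intro n hn
  by_cases h : p.coeff n = 0
  · exact hq n fun h' => hn (by simp [h, h'])
  · exact hp n h

lemma FreqBound.neg {R : ℝ} {p : TrigPoly} (hp : FreqBound R p) : FreqBound R (-p) :=
  fun n hn => hp n fun h => hn (by simp [h])

lemma FreqBound.sub {R : ℝ} {p q : TrigPoly} (hp : FreqBound R p) (hq : FreqBound R q) :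
    FreqBound R (p - q) := by
  rw [sub_eq_add_neg]
  exact hp.add hq.neg

lemma FreqBound.mul {R R' : ℝ} {p q : TrigPoly} (hp : FreqBound R p) (hq : FreqBound R' q) :
    FreqBound (R + R') (p * q) := by
  intro n hn
  rw [← dmul_coeff, dmul] at hn
  obtain ⟨m, hm⟩ : ∃ m, p.coeff m * q.coeff (n - m) ≠ 0 := by
    by_contra! h
    exact hn (by simp [h])
  have h := fnorm_add_le m (n - m)
  rw [add_sub_cancel] at h
  linarith [hp m (left_ne_zero_of_mul hm), hq (n - m) (right_ne_zero_of_mul hm)]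

lemma norm_toL2_bracketPow_le {s R : ℝ} (hs : 0 ≤ s) {p : TrigPoly} (hR : 0 ≤ R)
    (hp : FreqBound R p) : ‖toL2 (bracketPow s p)‖ ≤ (1 + R) ^ s * ‖toL2 p‖ := by
  refine norm_toL2_le_of_coeff_le (by positivity) fun n => ?_
  rw [coeff_bracketPow, norm_mul, Complex.norm_real,
    Real.norm_of_nonneg (Real.rpow_nonneg (jap_pos n).le _)]
  by_cases h : p.coeff n = 0
  · simp [h]
  · have := jap_pos n
    gcongr
    linarith [jap_le_one_add_fnorm n, hp n h]

lemma abs_rpow_sub_one_le {s t T : ℝ} (hs : 0 < s) (ht : 0 < t) (htT : t ≤ T) (hT : 1 ≤ T) :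
    |t ^ s - 1| ≤ (1 + s * T ^ s) * |t - 1| := by
  have hTs : 1 ≤ T ^ s := Real.one_le_rpow hT hs.le
  rcases le_total t 1 with h1 | h1
  · rw [abs_of_nonpos (by linarith [Real.rpow_le_one ht.le h1 hs.le]), abs_of_nonpos (by linarith)]
    rcases le_total s 1 with h2 | h2
    · have : t ≤ t ^ s := by
        simpa using Real.rpow_le_rpow_of_exponent_ge ht h1 h2
      nlinarith [mul_nonneg (mul_nonneg hs.le (zero_le_one.trans hTs)) (sub_nonneg.2 h1)]
    · have := one_add_mul_self_le_rpow_one_add (s := t - 1) (by linarith) h2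
      rw [add_sub_cancel] at this
      nlinarith [mul_nonneg (mul_nonneg hs.le (sub_nonneg.2 hTs)) (sub_nonneg.2 h1)]
  · rw [abs_of_nonneg (by linarith [Real.one_le_rpow h1 hs.le]), abs_of_nonneg (by linarith)]
    rcases le_total s 1 with h2 | h2
    · have : t ^ s ≤ t := by
        simpa using Real.rpow_le_rpow_of_exponent_le h1 h2
      nlinarith [mul_nonneg (mul_nonneg hs.le (zero_le_one.trans hTs)) (sub_nonneg.2 h1)]
    · have hti : 0 < t⁻¹ := inv_pos.2 ht
      have h3 := one_add_mul_self_le_rpow_one_add (s := t⁻¹ - 1) (by linarith) h2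
      rw [add_sub_cancel, Real.inv_rpow ht.le] at h3
      have h4 : 0 < t ^ s := Real.rpow_pos_of_pos ht _
      have h5 := mul_le_mul_of_nonneg_left h3 h4.le
      rw [mul_inv_cancel₀ h4.ne'] at h5
      have h6 : t ^ s ≤ T ^ s := Real.rpow_le_rpow ht.le htT hs.le
      have h7 : t ^ s * (1 - t⁻¹) ≤ T ^ s * (t - 1) := by
        refine mul_le_mul h6 ?_ ?_ (by linarith)
        · have : t⁻¹ * t = 1 := inv_mul_cancel₀ ht.ne'
          nlinarith [sq_nonneg (t - 1), inv_le_one_of_one_le₀ h1]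
        · linarith [inv_le_one_of_one_le₀ h1]
      nlinarith [mul_le_mul_of_nonneg_left h7 hs.le]

lemma abs_jap_rpow_sub_le {s b G : ℝ} (hs : 0 < s) (hb : 0 < b) {m k : Freq}
    (hbm : b ≤ jap m) (hmb : jap m ≤ 4 * b) (hk : fnorm k ≤ G) (hG : G ≤ 4 * b) :
    |jap (m + k) ^ s - jap m ^ s| ≤ (1 + s * 5 ^ s) * ((4 * b) ^ s * (G / b)) := by
  have hm := jap_pos m
  have hmk := jap_pos (m + k)
  have h1 := abs_jap_add_sub_le m k
  have hG0 : 0 ≤ G := (fnorm_nonneg k).trans hk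
  have h2 : |jap (m + k) / jap m - 1| ≤ G / b := by
    rw [div_sub_one hm.ne', abs_div, abs_of_pos hm]
    exact div_le_div₀ hG0 (h1.trans hk) hb hbm
  have h3 : jap (m + k) / jap m ≤ 5 := by
    have : G / b ≤ 4 := by rwa [div_le_iff₀ hb]
    linarith [(abs_le.1 h2).2]
  have h4 := abs_rpow_sub_one_le hs (div_pos hmk hm) h3 (by norm_num)
  have h5 : jap (m + k) ^ s - jap m ^ s = jap m ^ s * ((jap (m + k) / jap m) ^ s - 1) := by
    rw [Real.div_rpow hmk.le hm.le, mul_sub, mul_div_cancel₀ _ (Real.rpow_pos_of_pos hm s).ne',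
      mul_one]
  rw [h5, abs_mul, abs_of_pos (Real.rpow_pos_of_pos hm s)]
  calc jap m ^ s * |(jap (m + k) / jap m) ^ s - 1|
      ≤ (4 * b) ^ s * ((1 + s * 5 ^ s) * (G / b)) := by
        gcongr
        exact h4.trans (by gcongr)
    _ = _ := by ring

lemma sum_norm_coeff_le {G : ℕ} {g : TrigPoly} (hg : FreqBound G g) :
    ∑ k ∈ g.coeff.support, ‖g.coeff k‖ ≤ (2 * G + 1) * ‖toL2 g‖ := by
  refine pow_le_pow_iff_left₀ (Finset.sum_nonneg fun _ _ => norm_nonneg _)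
    (by positivity) two_ne_zero |>.1 ?_
  refine sq_sum_le_card_mul_sum_sq.trans ?_
  rw [mul_pow, norm_toL2_sq]
  gcongr
  have hsub : g.coeff.support ⊆
      Finset.Icc (-(G : ℤ)) G ×ˢ Finset.Icc (-(G : ℤ)) G := by
    intro n hn
    have h := hg n (Finsupp.mem_support_iff.1 hn)
    have h1 : |(n.1 : ℝ)| ≤ fnorm n := Real.abs_le_sqrt (by nlinarith)
    have h2 : |(n.2 : ℝ)| ≤ fnorm n := Real.abs_le_sqrt (by nlinarith)
    rw [Finset.mem_product, Finset.mem_Icc, Finset.mem_Icc, ← abs_le, ← abs_le]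
    exact ⟨by exact_mod_cast h1.trans h, by exact_mod_cast h2.trans h⟩
  have hcard := Finset.card_le_card hsub
  rw [Finset.card_product, Int.card_Icc,
    show ((G : ℤ) + 1 - -(G : ℤ)).toNat = 2 * G + 1 by omega] at hcard
  calc (g.coeff.support.card : ℝ) ≤ (((2 * G + 1) * (2 * G + 1) : ℕ) : ℝ) := by exact_mod_cast hcard
    _ = _ := by push_cast; ring

lemma norm_toL2_commutator_le {s b : ℝ} {G : ℕ} (hs : 0 < s) (hb : 0 < b) {g f : TrigPoly}
    (hg : FreqBound G g) (hG : G ≤ 4 * b)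
    (hf : ∀ m, f.coeff m ≠ 0 → b ≤ jap m ∧ jap m ≤ 4 * b) :
    ‖toL2 (bracketPow s (g * f) - g * bracketPow s f)‖ ≤
      (1 + s * 5 ^ s) * ((4 * b) ^ s * (G / b)) * ((2 * G + 1) * ‖toL2 g‖ * ‖toL2 f‖) := by
  set c := (1 + s * 5 ^ s) * ((4 * b) ^ s * (G / b)) with hc
  have hc0 : 0 ≤ c := by positivity
  set F : Freq → TrigPoly := fun k =>
    fourierMul (fun m => ((jap (m + k) ^ s - jap m ^ s : ℝ) : ℂ)) f
  have hdecomp : bracketPow s (g * f) - g * bracketPow s f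
      = ∑ k ∈ g.coeff.support, AddMonoidAlgebra.single k (g.coeff k) * F k := by
    have hgs : g = ∑ k ∈ g.coeff.support, AddMonoidAlgebra.single k (g.coeff k) :=
      (AddMonoidAlgebra.sum_coeff_single g).symm
    conv_lhs => rw [hgs]
    rw [Finset.sum_mul, Finset.sum_mul, map_sum, ← Finset.sum_sub_distrib]
    refine Finset.sum_congr rfl fun k _ => ?_
    ext n
    simp only [AddMonoidAlgebra.coeff_sub, Finsupp.sub_apply, coeff_bracketPow, F,
      AddMonoidAlgebra.coeff_single_mul_apply, coeff_fourierMul, add_comm (-k) n,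
      neg_add_cancel_right]
    push_cast
    ring
  have hF : ∀ k ∈ g.coeff.support, ‖toL2 (F k)‖ ≤ c * ‖toL2 f‖ := by
    intro k hk
    refine norm_toL2_le_of_coeff_le hc0 fun m => ?_
    rw [coeff_fourierMul, norm_mul, Complex.norm_real, Real.norm_eq_abs]
    by_cases h : f.coeff m = 0
    · simp [h]
    · gcongr
      exact abs_jap_rpow_sub_le hs hb (hf m h).1 (hf m h).2
        (hg k (Finsupp.mem_support_iff.1 hk)) hG
  rw [hdecomp, map_sum]
  calc ‖∑ k ∈ g.coeff.support, toL2 (AddMonoidAlgebra.single k (g.coeff k) * F k)‖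
      ≤ ∑ k ∈ g.coeff.support, ‖g.coeff k‖ * (c * ‖toL2 f‖) := by
        refine norm_sum_le_of_le _ fun k hk => (norm_toL2_mul_le _ _).trans ?_
        gcongr
        · exact norm_toTorus_single_le _ _
        · exact hF k hk
    _ = (∑ k ∈ g.coeff.support, ‖g.coeff k‖) * (c * ‖toL2 f‖) := by rw [Finset.sum_mul]
    _ ≤ ((2 * G + 1) * ‖toL2 g‖) * (c * ‖toL2 f‖) := by
        gcongr
        exact sum_norm_coeff_le hg
    _ = _ := by ring

/-- A sequence of trigonometric polynomials localised in dyadic annuli, with sup norms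
decaying like `K θ^j`. -/
structure DyadicDecay (θ K : ℝ) (f : ℕ → TrigPoly) : Prop where
  norm_le : ∀ j, ‖toTorus (f j)‖ ≤ K * θ ^ j
  le_jap : ∀ j m, (f j).coeff m ≠ 0 → (2 : ℝ) ^ j / 2 ≤ jap m
  freqBound : ∀ j, FreqBound (2 ^ j) (f j)

/-- The partial sum `∑_{i < j} f i`. -/
def partialSum (f : ℕ → TrigPoly) (j : ℕ) : TrigPoly := ∑ i ∈ Finset.range j, f i

lemma partialSum_succ (f : ℕ → TrigPoly) (j : ℕ) :
    partialSum f (j + 1) = partialSum f j + f j := Finset.sum_range_succ _ _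

/-- The cubic commutator `⟨∇⟩^s(p³) - 3p²⟨∇⟩^s p`. -/
def cubicCommutator (s : ℝ) (p : TrigPoly) : TrigPoly :=
  bracketPow s (p ^ 3) - (3 : ℂ) • (p ^ 2 * bracketPow s p)

lemma cubicCommutator_add_sub (s : ℝ) (S f L : TrigPoly) :
    cubicCommutator s (S + f) - cubicCommutator s S =
      bracketPow s ((((S + f) ^ 2 - L ^ 2) + ((S + f) * S - L ^ 2) + (S ^ 2 - L ^ 2)) * f)
      + (3 : ℂ) • (bracketPow s (L ^ 2 * f) - L ^ 2 * bracketPow s f)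
      - (3 : ℂ) • (((S + f) ^ 2 - L ^ 2) * bracketPow s f)
      - (3 : ℂ) • ((f * (S + f + S)) * bracketPow s S) := by
  have hsm : ∀ x : TrigPoly, (3 : ℂ) • x = 3 * x := fun x => by
    rw [Algebra.smul_def, map_ofNat]
  have hcube : (S + f) ^ 3 =
      S ^ 3 + (((S + f) ^ 2 - L ^ 2) + ((S + f) * S - L ^ 2) + (S ^ 2 - L ^ 2)) * f
        + (3 : ℂ) • (L ^ 2 * f) := by
    rw [hsm]; ring
  rw [cubicCommutator, cubicCommutator, hcube, map_add, map_add, map_smul, map_add]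
  simp only [hsm]
  ring

namespace DyadicDecay

variable {s θ K : ℝ} {f : ℕ → TrigPoly}

lemma nonneg (h : DyadicDecay θ K f) : 0 ≤ K := by
  have := (norm_nonneg _).trans (h.norm_le 0)
  simpa using this

lemma freqBound_partialSum (h : DyadicDecay θ K f) (j : ℕ) :
    FreqBound (2 ^ j) (partialSum f j) := by
  induction j with
  | zero => intro n hn; simp [partialSum] at hn
  | succ j ih =>
    rw [partialSum_succ]
    exact (ih.add (h.freqBound j)).mono (pow_le_pow_right₀ one_le_two j.le_succ)

lemma freqBound_partialSum_succ (h : DyadicDecay θ K f) (j : ℕ) :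
    FreqBound (2 ^ j) (partialSum f (j + 1)) := by
  rw [partialSum_succ]
  exact (h.freqBound_partialSum j).add (h.freqBound j)

lemma norm_partialSum_sub_le (h : DyadicDecay θ K f) (hθ : 0 < θ) (hθ1 : θ < 1) {i j : ℕ}
    (hij : i ≤ j) :
    ‖toTorus (partialSum f j) - toTorus (partialSum f i)‖ ≤ K * (1 - θ)⁻¹ * θ ^ i := by
  have hK := h.nonneg
  rw [partialSum, partialSum, ← map_sub, ← Finset.sum_Ico_eq_sub _ hij, map_sum]
  calc ‖∑ k ∈ Finset.Ico i j, toTorus (f k)‖ ≤ ∑ k ∈ Finset.Ico i j, K * θ ^ k :=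
        norm_sum_le_of_le _ fun k _ => h.norm_le k
    _ = K * ∑ k ∈ Finset.Ico i j, θ ^ k := by rw [Finset.mul_sum]
    _ ≤ K * (θ ^ i / (1 - θ)) := by
        gcongr
        exact geom_sum_Ico_le_of_lt_one hθ.le hθ1
    _ = _ := by rw [div_eq_mul_inv]; ring

lemma norm_partialSum_le (h : DyadicDecay θ K f) (hθ : 0 < θ) (hθ1 : θ < 1) (j : ℕ) :
    ‖toTorus (partialSum f j)‖ ≤ K * (1 - θ)⁻¹ := by
  have := h.norm_partialSum_sub_le hθ hθ1 (Nat.zero_le j)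
  simpa [partialSum] using this

lemma norm_mul_sub_sq_le (h : DyadicDecay θ K f) (hθ : 0 < θ) (hθ1 : θ < 1) {i j k : ℕ}
    (hij : i ≤ j) (hik : i ≤ k) :
    ‖toTorus (partialSum f j * partialSum f k - partialSum f i ^ 2)‖ ≤
      2 * (K * (1 - θ)⁻¹) ^ 2 * θ ^ i := by
  have hK := h.nonneg
  have hA : 0 < (1 - θ)⁻¹ := inv_pos.2 (by linarith)
  have heq : toTorus (partialSum f j * partialSum f k - partialSum f i ^ 2) =
      (toTorus (partialSum f j) - toTorus (partialSum f i)) * toTorus (partialSum f k)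
      + toTorus (partialSum f i) * (toTorus (partialSum f k) - toTorus (partialSum f i)) := by
    simp only [map_sub, map_mul, map_pow]
    ring
  rw [heq]
  calc _ ≤ (K * (1 - θ)⁻¹ * θ ^ i) * (K * (1 - θ)⁻¹)
          + (K * (1 - θ)⁻¹) * (K * (1 - θ)⁻¹ * θ ^ i) := by
        refine norm_add_le_of_le ((norm_mul_le _ _).trans ?_) ((norm_mul_le _ _).trans ?_)
        · gcongr
          · exact h.norm_partialSum_sub_le hθ hθ1 hij
          · exact h.norm_partialSum_le hθ hθ1 k
        · gcongr
          · exact h.norm_partialSum_le hθ hθ1 i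
          · exact h.norm_partialSum_sub_le hθ hθ1 hik
    _ = _ := by ring

lemma norm_toL2_le (h : DyadicDecay θ K f) (j : ℕ) : ‖toL2 (f j)‖ ≤ K * θ ^ j :=
  (SDNLW.norm_toL2_le _).trans (h.norm_le j)

lemma mul_two_pow_rpow {c : ℝ} (hc : 0 ≤ c) (s : ℝ) (j : ℕ) :
    (c * 2 ^ j) ^ s = c ^ s * ((2 : ℝ) ^ s) ^ j := by
  rw [Real.mul_rpow hc (by positivity), Real.rpow_pow_comm (by norm_num)]

lemma norm_toL2_bracketPow_le (h : DyadicDecay θ K f) (hs : 0 ≤ s) (j : ℕ) :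
    ‖toL2 (bracketPow s (f j))‖ ≤ 2 ^ s * K * (2 ^ s * θ) ^ j := by
  have h1 := SDNLW.norm_toL2_bracketPow_le hs (by positivity) (h.freqBound j)
  have h2 : (1 : ℝ) ≤ 2 ^ j := one_le_pow₀ one_le_two
  calc _ ≤ (1 + 2 ^ j) ^ s * ‖toL2 (f j)‖ := h1
    _ ≤ (2 * 2 ^ j) ^ s * (K * θ ^ j) := by
        gcongr
        · linarith
        · exact h.norm_toL2_le j
    _ = _ := by rw [mul_two_pow_rpow (by norm_num), mul_pow]; ring

lemma norm_toL2_bracketPow_partialSum_le (h : DyadicDecay θ K f) (hs : 0 ≤ s)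
    (hl : 1 < 2 ^ s * θ) (j : ℕ) :
    ‖toL2 (bracketPow s (partialSum f j))‖ ≤
      2 ^ s * K * (2 ^ s * θ - 1)⁻¹ * (2 ^ s * θ) ^ j := by
  have hK := h.nonneg
  rw [partialSum, map_sum, map_sum]
  calc _ ≤ ∑ i ∈ Finset.range j, 2 ^ s * K * (2 ^ s * θ) ^ i :=
        norm_sum_le_of_le _ fun i _ => h.norm_toL2_bracketPow_le hs i
    _ = 2 ^ s * K * (((2 ^ s * θ) ^ j - 1) / (2 ^ s * θ - 1)) := by
        rw [← Finset.mul_sum, geom_sum_eq hl.ne']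
    _ ≤ 2 ^ s * K * ((2 ^ s * θ) ^ j / (2 ^ s * θ - 1)) := by
        have : 0 < 2 ^ s * θ - 1 := by linarith
        gcongr
        linarith
    _ = _ := by rw [div_eq_mul_inv]; ring

/-- The part of an increment of the cubic commutator where two factors have comparably high
frequency and `⟨∇⟩^s` falls on the product. -/
lemma norm_toL2_bracketPow_sub_mul_le (h : DyadicDecay θ K f) (hs : 0 ≤ s) (hθ : 0 < θ)
    (hθ1 : θ < 1) {i j : ℕ} (hij : i ≤ j) :
    ‖toL2 (bracketPow s (((partialSum f (j + 1) ^ 2 - partialSum f i ^ 2)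
      + (partialSum f (j + 1) * partialSum f j - partialSum f i ^ 2)
      + (partialSum f j ^ 2 - partialSum f i ^ 2)) * f j))‖ ≤
      6 * 4 ^ s * ((1 - θ)⁻¹) ^ 2 * K ^ 3 * ((2 ^ s * θ) ^ j * θ ^ i) := by
  have hK := h.nonneg
  have hA : 0 < (1 - θ)⁻¹ := inv_pos.2 (by linarith)
  have hSi : FreqBound (2 ^ j) (partialSum f i) :=
    (h.freqBound_partialSum i).mono (pow_le_pow_right₀ one_le_two hij)
  have hSj := h.freqBound_partialSum j
  have hSj1 := h.freqBound_partialSum_succ j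
  set Q := (partialSum f (j + 1) ^ 2 - partialSum f i ^ 2)
      + (partialSum f (j + 1) * partialSum f j - partialSum f i ^ 2)
      + (partialSum f j ^ 2 - partialSum f i ^ 2) with hQ
  have hFB : FreqBound (2 ^ j + 2 ^ j + 2 ^ j) (Q * f j) := by
    refine FreqBound.mul ?_ (h.freqBound j)
    rw [hQ]
    simp only [pow_two (partialSum f _)]
    exact (((hSj1.mul hSj1).sub (hSi.mul hSi)).add ((hSj1.mul hSj).sub (hSi.mul hSi))).add
      ((hSj.mul hSj).sub (hSi.mul hSi))
  have hQn : ‖toTorus Q‖ ≤ 6 * (K * (1 - θ)⁻¹) ^ 2 * θ ^ i := by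
    have h1 := h.norm_mul_sub_sq_le hθ hθ1 (hij.trans j.le_succ) (hij.trans j.le_succ)
    have h2 := h.norm_mul_sub_sq_le hθ hθ1 (hij.trans j.le_succ) hij
    have h3 := h.norm_mul_sub_sq_le hθ hθ1 hij hij
    rw [← pow_two] at h1 h3
    rw [hQ, map_add, map_add]
    refine (norm_add₃_le.trans (add_le_add_three h1 h2 h3)).trans_eq (by ring)
  have h2j : (1 : ℝ) ≤ 2 ^ j := one_le_pow₀ one_le_two
  calc _ ≤ (1 + (2 ^ j + 2 ^ j + 2 ^ j)) ^ s * ‖toL2 (Q * f j)‖ :=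
        SDNLW.norm_toL2_bracketPow_le hs (by positivity) hFB
    _ ≤ (4 * 2 ^ j) ^ s * (6 * (K * (1 - θ)⁻¹) ^ 2 * θ ^ i * (K * θ ^ j)) := by
        gcongr
        · linarith
        · refine (norm_toL2_mul_le _ _).trans ?_
          gcongr
          exact h.norm_toL2_le j
    _ = _ := by rw [mul_two_pow_rpow (by norm_num), mul_pow]; ring

/-- The low-high part of an increment of the cubic commutator. -/
lemma norm_toL2_commutator_partialSum_le (h : DyadicDecay θ K f) (hs : 0 < s) (hθ : 0 < θ)
    (hθ1 : θ < 1) {i j : ℕ} (hij : i ≤ j) :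
    ‖toL2 (bracketPow s (partialSum f i ^ 2 * f j) - partialSum f i ^ 2 * bracketPow s (f j))‖ ≤
      20 * (1 + s * 5 ^ s) * 2 ^ s * ((1 - θ)⁻¹) ^ 2 * K ^ 3 *
        ((2 ^ s * θ) ^ j * (4 ^ i / 2 ^ j)) := by
  have hK := h.nonneg
  have hA : 0 < (1 - θ)⁻¹ := inv_pos.2 (by linarith)
  have h2i : (1 : ℝ) ≤ 2 ^ i := one_le_pow₀ one_le_two
  have h2ij : (2 : ℝ) ^ i ≤ 2 ^ j := pow_le_pow_right₀ one_le_two hij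
  have hg : FreqBound ((2 * 2 ^ i : ℕ) : ℝ) (partialSum f i ^ 2) := by
    have := (h.freqBound_partialSum i).mul (h.freqBound_partialSum i)
    rw [← pow_two] at this
    refine this.mono (le_of_eq ?_)
    push_cast
    ring
  have hgn : ‖toL2 (partialSum f i ^ 2)‖ ≤ (K * (1 - θ)⁻¹) ^ 2 := by
    refine (SDNLW.norm_toL2_le _).trans ?_
    rw [map_pow]
    refine (norm_pow_le _ 2).trans ?_
    gcongr
    exact h.norm_partialSum_le hθ hθ1 i
  have key := norm_toL2_commutator_le (b := 2 ^ j / 2) hs (by positivity) hg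
    (by push_cast; linarith) (f := f j) fun m hm =>
      ⟨h.le_jap j m hm, by
        linarith [jap_le_one_add_fnorm m, h.freqBound j m hm,
          one_le_pow₀ (n := j) (one_le_two (α := ℝ))]⟩
  calc _ ≤ _ := key
    _ ≤ (1 + s * 5 ^ s) * ((4 * (2 ^ j / 2)) ^ s * ((2 * 2 ^ i : ℕ) / (2 ^ j / 2))) *
          ((5 * 2 ^ i) * (K * (1 - θ)⁻¹) ^ 2 * (K * θ ^ j)) := by
        gcongr
        · push_cast; linarith
        · exact h.norm_toL2_le j
    _ = _ := by
        rw [show (4 * ((2 : ℝ) ^ j / 2)) = 2 * 2 ^ j by ring, mul_two_pow_rpow (by norm_num),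
          mul_pow, show (4 : ℝ) ^ i = 2 ^ i * 2 ^ i by rw [← mul_pow]; norm_num]
        push_cast
        field_simp
        ring

lemma norm_toL2_sub_mul_bracketPow_le (h : DyadicDecay θ K f) (hs : 0 ≤ s) (hθ : 0 < θ)
    (hθ1 : θ < 1) {i j : ℕ} (hij : i ≤ j) :
    ‖toL2 ((partialSum f (j + 1) ^ 2 - partialSum f i ^ 2) * bracketPow s (f j))‖ ≤
      2 * 2 ^ s * ((1 - θ)⁻¹) ^ 2 * K ^ 3 * ((2 ^ s * θ) ^ j * θ ^ i) := by
  have hK := h.nonneg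
  have hA : 0 < (1 - θ)⁻¹ := inv_pos.2 (by linarith)
  have h1 := h.norm_mul_sub_sq_le hθ hθ1 (hij.trans j.le_succ) (hij.trans j.le_succ)
  rw [← pow_two] at h1
  calc _ ≤ _ := norm_toL2_mul_le _ _
    _ ≤ (2 * (K * (1 - θ)⁻¹) ^ 2 * θ ^ i) * (2 ^ s * K * (2 ^ s * θ) ^ j) := by
        gcongr
        exact h.norm_toL2_bracketPow_le hs j
    _ = _ := by ring

lemma norm_toL2_mul_add_le (h : DyadicDecay θ K f) (hθ : 0 < θ)
    (hθ1 : θ < 1) (j : ℕ) (p : TrigPoly) :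
    ‖toL2 ((f j * (partialSum f (j + 1) + partialSum f j)) * p)‖ ≤
      2 * (1 - θ)⁻¹ * K ^ 2 * θ ^ j * ‖toL2 p‖ := by
  have hK := h.nonneg
  refine (norm_toL2_mul_le _ _).trans ?_
  gcongr
  rw [map_mul, map_add]
  calc _ ≤ _ := norm_mul_le _ _
    _ ≤ (K * θ ^ j) * (K * (1 - θ)⁻¹ + K * (1 - θ)⁻¹) := by
        gcongr
        · exact h.norm_le j
        · exact norm_add_le_of_le (h.norm_partialSum_le hθ hθ1 _) (h.norm_partialSum_le hθ hθ1 _)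
    _ = _ := by ring

lemma norm_toL2_mul_bracketPow_partialSum_le (h : DyadicDecay θ K f) (hs : 0 ≤ s) (hθ : 0 < θ)
    (hθ1 : θ < 1) (hl : 1 < 2 ^ s * θ) (j : ℕ) :
    ‖toL2 ((f j * (partialSum f (j + 1) + partialSum f j)) * bracketPow s (partialSum f j))‖ ≤
      2 * 2 ^ s * (1 - θ)⁻¹ * (2 ^ s * θ - 1)⁻¹ * K ^ 3 * ((2 ^ s * θ) ^ j * θ ^ j) := by
  have hK := h.nonneg
  have hA : 0 < (1 - θ)⁻¹ := inv_pos.2 (by linarith)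
  calc _ ≤ _ := h.norm_toL2_mul_add_le hθ hθ1 j _
    _ ≤ 2 * (1 - θ)⁻¹ * K ^ 2 * θ ^ j * (2 ^ s * K * (2 ^ s * θ - 1)⁻¹ * (2 ^ s * θ) ^ j) := by
        gcongr
        exact h.norm_toL2_bracketPow_partialSum_le hs hl j
    _ = _ := by ring

lemma norm_toL2_cubicCommutator_succ_sub_le (h : DyadicDecay θ K f) (hs : 0 < s) (hθ : 0 < θ)
    (hθ1 : θ < 1) (hl : 1 < 2 ^ s * θ) {i j : ℕ} (hij : i ≤ j) :
    ‖toL2 (cubicCommutator s (partialSum f (j + 1)) - cubicCommutator s (partialSum f j))‖ ≤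
      (6 * 4 ^ s * ((1 - θ)⁻¹) ^ 2 + 6 * 2 ^ s * ((1 - θ)⁻¹) ^ 2
        + 6 * 2 ^ s * (1 - θ)⁻¹ * (2 ^ s * θ - 1)⁻¹
        + 60 * (1 + s * 5 ^ s) * 2 ^ s * ((1 - θ)⁻¹) ^ 2) * K ^ 3 *
        ((2 ^ s * θ) ^ j * θ ^ i + (2 ^ s * θ) ^ j * (4 ^ i / 2 ^ j)) := by
  have hK := h.nonneg
  have hA : 0 < (1 - θ)⁻¹ := inv_pos.2 (by linarith)
  have hB : 0 < (2 ^ s * θ - 1)⁻¹ := inv_pos.2 (by linarith)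
  have h1 := h.norm_toL2_bracketPow_sub_mul_le hs.le hθ hθ1 hij
  have h2 := h.norm_toL2_commutator_partialSum_le hs hθ hθ1 hij
  have h3 := h.norm_toL2_sub_mul_bracketPow_le hs.le hθ hθ1 hij
  have h4 := h.norm_toL2_mul_bracketPow_partialSum_le hs.le hθ hθ1 hl j
  have hn3 : ‖(3 : ℂ)‖ = 3 := by norm_num
  rw [partialSum_succ, cubicCommutator_add_sub s _ _ (partialSum f i), ← partialSum_succ,
    map_sub, map_sub, map_add, map_smul, map_smul, map_smul]
  refine (norm_sub_le _ _).trans ((add_le_add_left ((norm_sub_le _ _).trans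
    (add_le_add_left (norm_add_le _ _) _)) _).trans ?_)
  rw [norm_smul, norm_smul, norm_smul, hn3]
  have h5 : (2 ^ s * θ) ^ j * θ ^ j ≤ (2 ^ s * θ) ^ j * θ ^ i :=
    mul_le_mul_of_nonneg_left (pow_le_pow_of_le_one hθ.le hθ1.le hij) (by positivity)
  have h6 := mul_le_mul_of_nonneg_left h5
    (show 0 ≤ 2 * 2 ^ s * (1 - θ)⁻¹ * (2 ^ s * θ - 1)⁻¹ * K ^ 3 by positivity)
  set X := (2 ^ s * θ) ^ j * θ ^ i
  set Y := (2 ^ s * θ) ^ j * ((4 : ℝ) ^ i / 2 ^ j)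
  have hX : 0 ≤ X := by positivity
  have hY : 0 ≤ Y := by positivity
  have h7 : 0 ≤ (6 * 4 ^ s * ((1 - θ)⁻¹) ^ 2 + 6 * 2 ^ s * ((1 - θ)⁻¹) ^ 2
        + 6 * 2 ^ s * (1 - θ)⁻¹ * (2 ^ s * θ - 1)⁻¹) * K ^ 3 * Y := by positivity
  have h8 : 0 ≤ (60 * (1 + s * 5 ^ s) * 2 ^ s * ((1 - θ)⁻¹) ^ 2) * K ^ 3 * X := by positivity
  linarith

lemma pow_div_three_le {β : ℝ} (hβ : 0 < β) (hβ1 : β ≤ 1) (j : ℕ) :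
    (β ^ 3) ^ (j / 3) ≤ (β ^ 2)⁻¹ * β ^ j := by
  rw [le_inv_mul_iff₀ (by positivity), ← pow_mul, ← pow_add]
  exact pow_le_pow_of_le_one hβ.le hβ1 (by omega)

lemma four_pow_div_three_le {γ : ℝ} (hγ : 1 ≤ γ) (hγ2 : γ ^ 3 = 2) (j : ℕ) :
    (4 : ℝ) ^ (j / 3) / 2 ^ j ≤ (γ⁻¹) ^ j := by
  have hγ0 : 0 < γ := by linarith
  rw [show (4 : ℝ) = γ ^ 6 by rw [show 6 = 3 * 2 by rfl, pow_mul, hγ2]; norm_num, ← hγ2,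
    div_le_iff₀ (by positivity), inv_pow, ← pow_mul, ← pow_mul,
    le_inv_mul_iff₀ (by positivity), ← pow_add]
  exact pow_le_pow_right₀ hγ (by omega)

lemma norm_toL2_cubicCommutator_le (hs : 0 < s) {β γ : ℝ} (hβ : 0 < β) (hβ1 : β < 1)
    (hβθ : β ^ 3 = θ) (hl : 1 < 2 ^ s * θ) (hlβ : 2 ^ s * θ * β < 1) (hγ : 1 ≤ γ)
    (hγ2 : γ ^ 3 = 2) (hlγ : 2 ^ s * θ * γ⁻¹ < 1) :
    ∃ C : ℝ, 0 < C ∧ ∀ (K : ℝ) (f : ℕ → TrigPoly), DyadicDecay θ K f → ∀ J : ℕ,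
      ‖toL2 (cubicCommutator s (partialSum f J))‖ ≤ C * K ^ 3 := by
  have hθ : 0 < θ := hβθ ▸ pow_pos hβ 3
  have hθ1 : θ < 1 := hβθ ▸ pow_lt_one₀ hβ.le hβ1 three_ne_zero
  have hA : 0 < (1 - θ)⁻¹ := inv_pos.2 (by linarith)
  have hB : 0 < (2 ^ s * θ - 1)⁻¹ := inv_pos.2 (by linarith)
  have hD : 0 < (1 - 2 ^ s * θ * β)⁻¹ := inv_pos.2 (by linarith)
  have hE : 0 < (1 - 2 ^ s * θ * γ⁻¹)⁻¹ := inv_pos.2 (by linarith)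
  obtain ⟨c, hc⟩ : ∃ c, c = 6 * 4 ^ s * ((1 - θ)⁻¹) ^ 2 + 6 * 2 ^ s * ((1 - θ)⁻¹) ^ 2
        + 6 * 2 ^ s * (1 - θ)⁻¹ * (2 ^ s * θ - 1)⁻¹
        + 60 * (1 + s * 5 ^ s) * 2 ^ s * ((1 - θ)⁻¹) ^ 2 := ⟨_, rfl⟩
  have hc0 : 0 < c := by rw [hc]; positivity
  refine ⟨c * ((β ^ 2)⁻¹ * (1 - 2 ^ s * θ * β)⁻¹ + (1 - 2 ^ s * θ * γ⁻¹)⁻¹),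
    by positivity, fun K f h J => ?_⟩
  have hK := h.nonneg
  have h0 : cubicCommutator s (partialSum f 0) = 0 := by
    simp [partialSum, cubicCommutator]
  rw [← sub_zero (cubicCommutator s (partialSum f J)), ← h0,
    ← Finset.sum_range_sub (fun j => cubicCommutator s (partialSum f j)), map_sum]
  calc _ ≤ ∑ j ∈ Finset.range J, c * K ^ 3 *
          ((β ^ 2)⁻¹ * (2 ^ s * θ * β) ^ j + (2 ^ s * θ * γ⁻¹) ^ j) := by
        refine norm_sum_le_of_le _ fun j _ => ?_
        refine (h.norm_toL2_cubicCommutator_succ_sub_le hs hθ hθ1 hl (Nat.div_le_self j 3)).trans ?_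
        rw [← hc]
        have h1 := pow_div_three_le hβ hβ1.le j
        rw [hβθ] at h1
        have h2 := four_pow_div_three_le hγ hγ2 j
        calc _ ≤ c * K ^ 3 * ((2 ^ s * θ) ^ j * ((β ^ 2)⁻¹ * β ^ j)
                + (2 ^ s * θ) ^ j * (γ⁻¹) ^ j) := by gcongr
          _ = _ := by simp only [mul_pow]; ring
    _ = c * K ^ 3 * ((β ^ 2)⁻¹ * ∑ j ∈ Finset.range J, (2 ^ s * θ * β) ^ j
          + ∑ j ∈ Finset.range J, (2 ^ s * θ * γ⁻¹) ^ j) := by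
        rw [← Finset.mul_sum, Finset.sum_add_distrib, ← Finset.mul_sum]
    _ ≤ c * K ^ 3 * ((β ^ 2)⁻¹ * (1 - 2 ^ s * θ * β)⁻¹ + (1 - 2 ^ s * θ * γ⁻¹)⁻¹) := by
        have hr : ∀ r : ℝ, 0 ≤ r → r < 1 → ∑ j ∈ Finset.range J, r ^ j ≤ (1 - r)⁻¹ :=
          fun r hr hr1 => by
            rw [← tsum_geometric_of_lt_one hr hr1]
            exact (summable_geometric_of_lt_one hr hr1).sum_le_tsum _ fun _ _ => by positivity
        gcongr
        · exact hr _ (by positivity) hlβ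
        · exact hr _ (by positivity) hlγ
    _ = _ := by ring

end DyadicDecay

lemma sum_norm_sq_le_of_tendsto {p : ℕ → TrigPoly} {v : Distr} {C : ℝ}
    (hp : ∀ n, Tendsto (fun J => (p J).coeff n) atTop (nhds (v n)))
    (hC : ∀ J, ‖toL2 (p J)‖ ≤ C) (F : Finset Freq) : ∑ n ∈ F, ‖v n‖ ^ 2 ≤ C ^ 2 := by
  have h : Tendsto (fun J => ∑ n ∈ F, ‖(p J).coeff n‖ ^ 2) atTop (nhds (∑ n ∈ F, ‖v n‖ ^ 2)) :=
    tendsto_finsetSum _ fun n _ => (hp n).norm.pow 2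
  refine le_of_tendsto' h fun J => ?_
  refine (sum_le_hasSum F (fun _ _ => by positivity) (hasSum_norm_toL2_sq (p J))).trans ?_
  have := norm_nonneg (toL2 (p J))
  gcongr
  exact hC J

lemma L2Norm_eq (v : Distr) : L2Norm v = (∑' n, (‖v n‖₊ : ℝ≥0∞) ^ 2) ^ (1 / 2 : ℝ) := by
  simp [L2Norm, sobNorm]

lemma L2Norm_le_of_tendsto {p : ℕ → TrigPoly} {v : Distr} {C : ℝ}
    (hp : ∀ n, Tendsto (fun J => (p J).coeff n) atTop (nhds (v n)))
    (hC : ∀ J, ‖toL2 (p J)‖ ≤ C) : L2Norm v ≤ ENNReal.ofReal C := by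
  have hC0 : 0 ≤ C := (norm_nonneg _).trans (hC 0)
  have h : ∑' n, (‖v n‖₊ : ℝ≥0∞) ^ 2 ≤ ENNReal.ofReal C ^ 2 := by
    refine ENNReal.summable.tsum_le_of_sum_le fun F => ?_
    have h1 := ENNReal.ofReal_le_ofReal (sum_norm_sq_le_of_tendsto hp hC F)
    rw [ENNReal.ofReal_sum_of_nonneg fun _ _ => by positivity, ENNReal.ofReal_pow hC0] at h1
    refine le_of_eq_of_le (Finset.sum_congr rfl fun n _ => ?_) h1
    rw [ENNReal.ofReal_pow (norm_nonneg _), ofReal_norm, enorm_eq_nnnorm]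
  rw [L2Norm_eq]
  calc _ ≤ (ENNReal.ofReal C ^ 2) ^ (1 / 2 : ℝ) := by gcongr
    _ = _ := by
      rw [← ENNReal.rpow_natCast, ← ENNReal.rpow_mul]
      norm_num

lemma tendsto_dmul {a b : ℕ → Distr} {v w : Distr} {n : Freq} {bound : Freq → ℝ}
    (hbound : Summable bound) (ha : ∀ m, Tendsto (fun J => a J m) atTop (nhds (v m)))
    (hb : ∀ m, Tendsto (fun J => b J m) atTop (nhds (w m)))
    (hab : ∀ J m, ‖a J m * b J (n - m)‖ ≤ bound m) :
    Tendsto (fun J => dmul (a J) (b J) n) atTop (nhds (dmul v w n)) :=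
  tendsto_tsum_of_dominated_convergence hbound (fun m => (ha m).mul (hb (n - m)))
    (Eventually.of_forall fun J m => hab J m)

lemma dmul_comm (v w : Distr) : dmul v w = dmul w v := by
  funext n
  rw [dmul, dmul, ← (Equiv.subLeft n).tsum_eq]
  exact tsum_congr fun m => by simp [mul_comm]

lemma finite_fnorm_le (R : ℝ) : {n : Freq | fnorm n ≤ R}.Finite := by
  refine (Set.finite_Icc ((-⌊R⌋, -⌊R⌋) : Freq) (⌊R⌋, ⌊R⌋)).subset fun n hn => ?_
  have h1 : |(n.1 : ℝ)| ≤ fnorm n := Real.abs_le_sqrt (by nlinarith)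
  have h2 : |(n.2 : ℝ)| ≤ fnorm n := Real.abs_le_sqrt (by nlinarith)
  have h3 : |n.1| ≤ ⌊R⌋ := Int.le_floor.2 (by push_cast; exact h1.trans hn)
  have h4 : |n.2| ≤ ⌊R⌋ := Int.le_floor.2 (by push_cast; exact h2.trans hn)
  exact ⟨⟨(abs_le.1 h3).1, (abs_le.1 h4).1⟩, ⟨(abs_le.1 h3).2, (abs_le.1 h4).2⟩⟩

lemma fnorm_le_of_LP_ne_zero {u : Distr} {j : ℕ} {n : Freq} (h : LP j u n ≠ 0) :
    fnorm n ≤ 2 ^ j := by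
  have h := Set.mem_of_indicator_ne_zero h
  rw [Set.mem_ofPred_eq] at h
  split_ifs at h with hj
  · simpa [hj] using h
  · exact h.2

/-- The Littlewood–Paley piece `LP j u` as a trigonometric polynomial. -/
def lpPoly (u : Distr) (j : ℕ) : TrigPoly :=
  .ofCoeff (Finsupp.ofSupportFinite (LP j u)
    ((finite_fnorm_le (2 ^ j)).subset fun _ hn => fnorm_le_of_LP_ne_zero hn))

lemma coe_coeff_lpPoly (u : Distr) (j : ℕ) : ⇑(lpPoly u j).coeff = LP j u := rfl

lemma coeff_partialSum_succ (u : Distr) (j : ℕ) (n : Freq) :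
    (partialSum (lpPoly u) (j + 1)).coeff n = {n : Freq | fnorm n ≤ 2 ^ j}.indicator u n := by
  induction j with
  | zero =>
    simp [partialSum, coe_coeff_lpPoly, LP]
  | succ j ih =>
    rw [partialSum_succ, AddMonoidAlgebra.coeff_add, Finsupp.add_apply, ih, coe_coeff_lpPoly, LP]
    have h2 : (2 : ℝ) ^ j ≤ 2 ^ (j + 1) := pow_le_pow_right₀ one_le_two j.le_succ
    simp only [Set.indicator_apply, Set.mem_ofPred_eq, Nat.add_eq_zero_iff, one_ne_zero, and_false,
      if_false, Nat.add_sub_cancel]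
    by_cases h : fnorm n ≤ 2 ^ j
    · simp [h, h.trans h2, not_lt.2 h]
    · simp [h, not_le.1 h]

lemma norm_coeff_partialSum_le (u : Distr) (J : ℕ) (n : Freq) :
    ‖(partialSum (lpPoly u) J).coeff n‖ ≤ ‖u n‖ := by
  cases J with
  | zero => simp [partialSum]
  | succ j =>
    rw [coeff_partialSum_succ]
    exact norm_indicator_le_norm_self _ _

lemma tendsto_coeff_partialSum (u : Distr) (n : Freq) :
    Tendsto (fun J => (partialSum (lpPoly u) J).coeff n) atTop (nhds (u n)) := by
  obtain ⟨k, hk⟩ := pow_unbounded_of_one_lt (fnorm n) one_lt_two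
  rw [← tendsto_add_atTop_iff_nat 1]
  refine tendsto_const_nhds.congr' ?_
  filter_upwards [eventually_ge_atTop k] with J hJ
  rw [coeff_partialSum_succ, Set.indicator_of_mem]
  exact hk.le.trans (pow_le_pow_right₀ one_le_two hJ)

lemma partialSum_sq_eq_sum (f : ℕ → TrigPoly) (J : ℕ) :
    partialSum f J ^ 2 =
      ∑ j ∈ Finset.range J, f j * (partialSum f (j + 1) + partialSum f j) := by
  have h := Finset.sum_range_sub (fun j => partialSum f j ^ 2) J
  have h0 : partialSum f 0 = 0 := by simp [partialSum]
  rw [h0, zero_pow two_ne_zero, sub_zero] at h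
  rw [← h]
  refine Finset.sum_congr rfl fun j _ => ?_
  rw [partialSum_succ]
  ring

lemma sum_norm_mul_coeff_le (g q : TrigPoly) (n : Freq) :
    ∑ m ∈ g.coeff.support, ‖g.coeff m‖ * ‖q.coeff (n - m)‖ ≤ ‖toL2 g‖ * ‖toL2 q‖ := by
  refine (Real.sum_mul_le_sqrt_mul_sqrt _ _ _).trans ?_
  gcongr
  · rw [← norm_toL2_sq, Real.sqrt_sq (norm_nonneg _)]
  · rw [Real.sqrt_le_left (norm_nonneg _)]
    exact sum_le_hasSum _ (fun _ _ => by positivity)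
      ((Equiv.subLeft n).hasSum_iff.2 (hasSum_norm_toL2_sq q))

lemma tendsto_coeff_partialSum_sq {u : Distr} (hu : Summable fun m => ‖u m‖ ^ 2) (n : Freq) :
    Tendsto (fun J => (partialSum (lpPoly u) J ^ 2).coeff n) atTop (nhds (dmul u u n)) := by
  simp only [pow_two, ← dmul_coeff]
  refine tendsto_dmul (bound := fun m => ‖u m‖ ^ 2 + ‖u (n - m)‖ ^ 2)
    (hu.add (hu.comp_injective (Equiv.subLeft n).injective)) (tendsto_coeff_partialSum u)
    (tendsto_coeff_partialSum u) fun J m => ?_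
  rw [norm_mul]
  calc _ ≤ ‖u m‖ * ‖u (n - m)‖ := by
        gcongr <;> exact norm_coeff_partialSum_le _ _ _
    _ ≤ _ := by nlinarith [sq_nonneg (‖u m‖ - ‖u (n - m)‖), sq_nonneg (‖u m‖ + ‖u (n - m)‖)]

namespace DyadicDecay

variable {s θ K : ℝ} {f : ℕ → TrigPoly} {u : Distr}

lemma summable_norm_sq (h : DyadicDecay θ K (lpPoly u)) (hθ : 0 < θ) (hθ1 : θ < 1) :
    Summable fun m => ‖u m‖ ^ 2 :=
  summable_of_sum_le (fun _ => by positivity) <|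
    sum_norm_sq_le_of_tendsto (tendsto_coeff_partialSum u) fun J =>
      (SDNLW.norm_toL2_le _).trans (h.norm_partialSum_le hθ hθ1 J)

lemma norm_toL2_mul_add_partialSum_le (h : DyadicDecay θ K f) (hθ : 0 < θ) (hθ1 : θ < 1)
    (j : ℕ) :
    ‖toL2 (f j * (partialSum f (j + 1) + partialSum f j))‖ ≤
      2 * (1 - θ)⁻¹ * K ^ 2 * θ ^ j := by
  have hθ2 : 0 < (1 - θ)⁻¹ := inv_pos.2 (by linarith)
  have h1 := h.norm_toL2_mul_add_le hθ hθ1 j 1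
  rw [mul_one] at h1
  exact h1.trans (mul_le_of_le_one_right (by positivity) norm_toL2_one_le)

lemma jap_rpow_mul_norm_le {c j : ℕ} {n m : Freq} (h : DyadicDecay θ K (lpPoly u))
    (hn : fnorm n ≤ 2 ^ c)
    (hm : (lpPoly u j * (partialSum (lpPoly u) (j + 1) + partialSum (lpPoly u) j)).coeff m ≠ 0) :
    jap (n - m) ^ s * ‖u (n - m)‖ ≤
      ‖(bracketPow s (partialSum (lpPoly u) (j + c + 3))).coeff (n - m)‖ := by
  have h1 := (h.freqBound j).mul ((h.freqBound_partialSum_succ j).add (h.freqBound_partialSum j))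
    m hm
  have h2 := fnorm_add_le n (-m)
  rw [fnorm_neg, ← sub_eq_add_neg] at h2
  have h3 : (2 : ℝ) ^ j ≤ 2 ^ (j + c) := pow_le_pow_right₀ one_le_two (by omega)
  have h4 : (2 : ℝ) ^ c ≤ 2 ^ (j + c) := pow_le_pow_right₀ one_le_two (by omega)
  rw [coeff_bracketPow, coeff_partialSum_succ, Set.indicator_of_mem, norm_mul, Complex.norm_real,
    Real.norm_of_nonneg (Real.rpow_nonneg (jap_pos _).le _)]
  rw [Set.mem_ofPred_eq, pow_add]
  linarith [pow_pos (two_pos (α := ℝ)) (j + c)]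

lemma exists_summable_bound (h : DyadicDecay θ K (lpPoly u)) (hs : 0 ≤ s) (hθ : 0 < θ)
    (hθ1 : θ < 1) (hl : 1 < 2 ^ s * θ) (hlθ : 2 ^ s * θ * θ < 1) (n : Freq) :
    ∃ B : Freq → ℝ, (∀ J m, ‖(partialSum (lpPoly u) J ^ 2).coeff m‖ ≤ B m) ∧
      Summable fun m => B m * (jap (n - m) ^ s * ‖u (n - m)‖) := by
  set g : ℕ → TrigPoly := fun j =>
    lpPoly u j * (partialSum (lpPoly u) (j + 1) + partialSum (lpPoly u) j) with hg
  have hgn : ∀ j, ‖toL2 (g j)‖ ≤ 2 * (1 - θ)⁻¹ * K ^ 2 * θ ^ j :=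
    h.norm_toL2_mul_add_partialSum_le hθ hθ1
  have hgs : ∀ m, Summable fun j => ‖(g j).coeff m‖ := fun m =>
    Summable.of_nonneg_of_le (fun _ => norm_nonneg _)
      (fun j => (norm_coeff_le _ _).trans (hgn j))
      ((summable_geometric_of_lt_one hθ.le hθ1).mul_left _)
  refine ⟨fun m => ∑' j, ‖(g j).coeff m‖, fun J m => ?_, ?_⟩
  · rw [partialSum_sq_eq_sum, AddMonoidAlgebra.coeff_sum, Finsupp.finsetSum_apply]
    exact (norm_sum_le _ _).trans ((hgs m).sum_le_tsum _ fun _ _ => norm_nonneg _)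
  have hw : ∀ m, 0 ≤ jap (n - m) ^ s * ‖u (n - m)‖ := fun m =>
    mul_nonneg (Real.rpow_nonneg (jap_pos _).le _) (norm_nonneg _)
  have hsupp : ∀ j, ∀ m ∉ (g j).coeff.support,
      ‖(g j).coeff m‖ * (jap (n - m) ^ s * ‖u (n - m)‖) = 0 := fun j m hm => by
    rw [Finsupp.notMem_support_iff.1 hm, norm_zero, zero_mul]
  obtain ⟨c, hc⟩ := pow_unbounded_of_one_lt (fnorm n) one_lt_two
  have hF : Summable fun x : ℕ × Freq =>
      ‖(g x.1).coeff x.2‖ * (jap (n - x.2) ^ s * ‖u (n - x.2)‖) := by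
    refine (summable_prod_of_nonneg fun x => mul_nonneg (norm_nonneg _) (hw _)).2
      ⟨fun j => summable_of_ne_finset_zero (s := (g j).coeff.support) (hsupp j), ?_⟩
    refine Summable.of_nonneg_of_le
      (fun j => tsum_nonneg fun m => mul_nonneg (norm_nonneg _) (hw _))
      (fun j => ?_) ((summable_geometric_of_lt_one (by positivity) hlθ).mul_left
        (2 * (1 - θ)⁻¹ * K ^ 2 * (2 ^ s * K * (2 ^ s * θ - 1)⁻¹) * (2 ^ s * θ) ^ (c + 3)))
    rw [tsum_eq_sum (hsupp j)]
    calc _ ≤ ∑ m ∈ (g j).coeff.support, ‖(g j).coeff m‖ *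
            ‖(bracketPow s (partialSum (lpPoly u) (j + c + 3))).coeff (n - m)‖ := by
          refine Finset.sum_le_sum fun m hm => ?_
          gcongr
          exact h.jap_rpow_mul_norm_le hc.le (Finsupp.mem_support_iff.1 hm)
      _ ≤ ‖toL2 (g j)‖ * ‖toL2 (bracketPow s (partialSum (lpPoly u) (j + c + 3)))‖ :=
          sum_norm_mul_coeff_le _ _ _
      _ ≤ (2 * (1 - θ)⁻¹ * K ^ 2 * θ ^ j) *
            (2 ^ s * K * (2 ^ s * θ - 1)⁻¹ * (2 ^ s * θ) ^ (j + c + 3)) :=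
          mul_le_mul (hgn j) (h.norm_toL2_bracketPow_partialSum_le hs hl _) (norm_nonneg _)
            ((norm_nonneg _).trans (hgn j))
      _ = _ := by rw [add_assoc, pow_add, mul_pow (2 ^ s * θ) θ]; ring
  simpa only [Prod.fst_swap, Prod.snd_swap, tsum_mul_right] using hF.prod_symm.prod

lemma tendsto_coeff_cubicCommutator (h : DyadicDecay θ K (lpPoly u)) (hs : 0 ≤ s) (hθ : 0 < θ)
    (hθ1 : θ < 1) (hl : 1 < 2 ^ s * θ) (hlθ : 2 ^ s * θ * θ < 1) (n : Freq) :
    Tendsto (fun J => (cubicCommutator s (partialSum (lpPoly u) J)).coeff n) atTop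
      (nhds ((japMul s (cube u) - (3 : ℂ) • dmul (dmul u u) (japMul s u)) n)) := by
  obtain ⟨B, hB, hBs⟩ := h.exists_summable_bound hs hθ hθ1 hl hlθ n
  have hB0 : ∀ m, 0 ≤ B m := fun m => (norm_nonneg _).trans (hB 0 m)
  have hsq := tendsto_coeff_partialSum_sq (h.summable_norm_sq hθ hθ1)
  have hjap : ∀ k, 1 ≤ jap k ^ s := fun k => Real.one_le_rpow (one_le_jap k) hs
  have hcube : Tendsto (fun J => (partialSum (lpPoly u) J ^ 3).coeff n) atTop
      (nhds (cube u n)) := by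
    simp only [cube, dmul_comm u (dmul u u), pow_succ _ 2, ← dmul_coeff]
    refine tendsto_dmul hBs hsq (tendsto_coeff_partialSum u) fun J m => ?_
    rw [norm_mul]
    refine mul_le_mul (hB J m) ?_ (norm_nonneg _) (hB0 m)
    exact (norm_coeff_partialSum_le _ _ _).trans
      (le_mul_of_one_le_left (norm_nonneg _) (hjap _))
  have hmul : Tendsto (fun J => (partialSum (lpPoly u) J ^ 2 *
      bracketPow s (partialSum (lpPoly u) J)).coeff n) atTop
      (nhds (dmul (dmul u u) (japMul s u) n)) := by
    simp only [← dmul_coeff]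
    refine tendsto_dmul hBs hsq (fun m => (tendsto_coeff_partialSum u m).const_mul _)
      fun J m => ?_
    rw [norm_mul]
    refine mul_le_mul (hB J m) ?_ (norm_nonneg _) (hB0 m)
    have := hjap (n - m)
    rw [coeff_bracketPow, norm_mul, Complex.norm_real, Real.norm_of_nonneg (by linarith)]
    gcongr
    exact norm_coeff_partialSum_le _ _ _
  exact (hcube.const_mul _).sub (hmul.const_mul 3)

end DyadicDecay

lemma norm_eval_LP_le {σ : ℝ} {u : Distr} (hu : CNorm σ u ≠ ⊤) (j : ℕ) (x : ℝ × ℝ) :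
    ‖eval (LP j u) x‖ ≤ (CNorm σ u).toReal * (2 ^ (-σ)) ^ j := by
  have h1 : ENNReal.ofReal (2 ^ (j * σ)) * ENNReal.ofReal ‖eval (LP j u) x‖ ≤ CNorm σ u := by
    refine le_trans ?_
      (le_iSup (fun j : ℕ => ENNReal.ofReal ((2 : ℝ) ^ ((j : ℝ) * σ)) * linfNorm (LP j u)) j)
    gcongr
    rw [ofReal_norm, enorm_eq_nnnorm]
    exact le_iSup (fun x => (‖eval (LP j u) x‖₊ : ℝ≥0∞)) x
  rw [← ENNReal.ofReal_mul (by positivity), ENNReal.ofReal_le_iff_le_toReal hu] at h1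
  rw [← Real.rpow_mul_natCast two_pos.le, neg_mul, Real.rpow_neg two_pos.le, mul_comm σ,
    ← div_eq_mul_inv, le_div_iff₀ (by positivity), mul_comm]
  exact h1

lemma dyadicDecay_lpPoly {σ : ℝ} {u : Distr} (hu : CNorm σ u ≠ ⊤) :
    DyadicDecay (2 ^ (-σ)) (CNorm σ u).toReal (lpPoly u) where
  norm_le j := norm_toTorus_le (by positivity) (norm_eval_LP_le hu j)
  le_jap j m hm := by
    have h := Set.mem_of_indicator_ne_zero hm
    rw [Set.mem_ofPred_eq] at h
    cases j with
    | zero => linarith [one_le_jap m]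
    | succ j =>
      rw [pow_succ, mul_div_cancel_right₀ _ two_ne_zero]
      exact h.1.le.trans (fnorm_le_jap m)
  freqBound j m hm := fnorm_le_of_LP_ne_zero hm

end SDNLW

open SDNLW in
/-- commutator estimate: for `s > 0` and `0 < ε < (1/4)·min(s,1)`,
`‖⟨∇⟩^s(u³) - 3u²⟨∇⟩^s u‖_{L²(𝕋²)} ≲ ‖u‖³_{C^{s-ε}(𝕋²)}`. -/
theorem statement4 (s ε : ℝ) (hs : 0 < s) (hε : 0 < ε) (hε' : ε < (1 / 4) * min s 1) :
    ∃ C : ℝ≥0, 0 < C ∧ ∀ u : Distr,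
      L2Norm (japMul s (cube u) - (3 : ℂ) • dmul (dmul u u) (japMul s u))
        ≤ C * (CNorm (s - ε) u) ^ 3 := by
  have hεs : ε < s / 4 := by linarith [min_le_left s 1]
  have hε1 : ε < 1 / 4 := by linarith [min_le_right s 1]
  have h2 : (0 : ℝ) < 2 := two_pos
  have hθ : (0 : ℝ) < 2 ^ (-(s - ε)) := by positivity
  have hθ1 : (2 : ℝ) ^ (-(s - ε)) < 1 := Real.rpow_lt_one_of_one_lt_of_neg one_lt_two (by linarith)
  have hl : (1 : ℝ) < 2 ^ s * 2 ^ (-(s - ε)) := by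
    rw [← Real.rpow_add h2]
    exact Real.one_lt_rpow one_lt_two (by linarith)
  have hlθ : (2 : ℝ) ^ s * 2 ^ (-(s - ε)) * 2 ^ (-(s - ε)) < 1 := by
    rw [← Real.rpow_add h2, ← Real.rpow_add h2]
    exact Real.rpow_lt_one_of_one_lt_of_neg one_lt_two (by linarith)
  obtain ⟨C, hC, hCu⟩ := DyadicDecay.norm_toL2_cubicCommutator_le (s := s)
    (θ := 2 ^ (-(s - ε))) (β := 2 ^ (-(s - ε) / 3)) (γ := 2 ^ (1 / 3 : ℝ)) hs (by positivity)
    (Real.rpow_lt_one_of_one_lt_of_neg one_lt_two (by linarith))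
    (by rw [← Real.rpow_mul_natCast h2.le]; congr 1; push_cast; ring) hl
    (by
      rw [← Real.rpow_add h2, ← Real.rpow_add h2]
      exact Real.rpow_lt_one_of_one_lt_of_neg one_lt_two (by linarith))
    (Real.one_le_rpow one_le_two (by norm_num))
    (by rw [← Real.rpow_mul_natCast h2.le]; norm_num)
    (by
      rw [← Real.rpow_neg h2.le, ← Real.rpow_add h2, ← Real.rpow_add h2]
      exact Real.rpow_lt_one_of_one_lt_of_neg one_lt_two (by linarith))
  refine ⟨C.toNNReal, Real.toNNReal_pos.2 hC, fun u => ?_⟩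
  by_cases hu : CNorm (s - ε) u = ⊤
  · rw [hu, ENNReal.top_pow three_ne_zero,
      ENNReal.mul_top (by simpa using hC)]
    exact le_top
  have h := dyadicDecay_lpPoly hu
  refine (L2Norm_le_of_tendsto (h.tendsto_coeff_cubicCommutator hs.le hθ hθ1 hl hlθ)
    (hCu _ _ h)).trans_eq ?_
  rw [ENNReal.ofReal_mul hC.le, ENNReal.ofReal_pow ENNReal.toReal_nonneg, ENNReal.ofReal_toReal hu]
  rfl
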